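/- For even n ≥ 4, the number of binary partial words of length n with exactly one hole, located at a position i with 0 ≤ i ≤ n/2 − 1, such that the first half (positions 0 through n/2 − 1) contains no occurrence of the letter 1, and whose minimal abelian border length equals n−1, is (n/2 − 1)·2^{n/2 − 2}. -/

import Mathlib

/-- A partial word over alphabet `α` is a list over `Option α`; `none` is a hole. -/
abbrev PWord (α : Type*) := List (Option α)

/-- `c` is a completion of the partial word `w`: a total word of the same length
agreeing with `w` on every non-hole position. -/
def IsCompletion {α : Type*} (w : PWord α) (c : List α) : Prop :=
  List.Forall₂ (fun o a => ∀ x, o = some x → x = a) w c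

/-- Two partial words are abelian compatible if they admit completions that are
permutations of one another (abelian equivalent). -/
def AbelianCompat {α : Type*} (u v : PWord α) : Prop :=
  ∃ cu cv, IsCompletion u cu ∧ IsCompletion v cv ∧ cu.Perm cv

/-- A partial word `w` has an abelian border of length `k`, `1 ≤ k ≤ |w| - 1`, if
its prefix of length `k` is abelian compatible with its suffix of length `k`. -/
def HasAbelianBorder {α : Type*} (w : PWord α) (k : ℕ) : Prop :=
  1 ≤ k ∧ k ≤ w.length - 1 ∧ AbelianCompat (w.take k) (w.drop (w.length - k))

/-- A total word `w` has an abelian border of length `k`, `1 ≤ k ≤ |w| - 1`, if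
its prefix of length `k` is a permutation of its suffix of length `k`. -/
def HasAbelianBorderT {α : Type*} (w : List α) (k : ℕ) : Prop :=
  1 ≤ k ∧ k ≤ w.length - 1 ∧ (w.take k).Perm (w.drop (w.length - k))

theorem IsCompletion.length_eq {α : Type*} {w : PWord α} {c : List α} (h : IsCompletion w c) :
    w.length = c.length :=
  List.Forall₂.length_eq h

theorem IsCompletion.count_bounds {α : Type*} [DecidableEq α] (a : α) {w : PWord α} {c : List α}
    (h : IsCompletion w c) :
    w.count (some a) ≤ c.count a ∧ c.count a ≤ w.count (some a) + w.count none := by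
  induction h with
  | nil => simp
  | @cons o b w c hob _ ih =>
    rcases o with _ | x
    · simp only [List.count_cons]
      by_cases hb : b = a <;> simp [hb] <;> omega
    · have hx : x = b := hob x rfl
      subst hx
      simp only [List.count_cons]
      by_cases hb : x = a <;> simp [hb] <;> omega

theorem exists_isCompletion_count_one (w : PWord (Fin 2)) (t : ℕ) (h₁ : w.count (some 1) ≤ t)
    (h₂ : t ≤ w.count (some 1) + w.count none) : ∃ c, IsCompletion w c ∧ c.count 1 = t := by
  induction w generalizing t with
  | nil => exact ⟨[], List.Forall₂.nil, by simp at h₂; simp [h₂]⟩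
  | cons o w ih =>
    rcases o with _ | x
    · simp at h₁ h₂
      by_cases ht : t ≤ w.count (some 1) + w.count none
      · obtain ⟨c, hc, hct⟩ := ih t h₁ ht
        exact ⟨0 :: c, List.Forall₂.cons (by simp) hc, by simp [hct]⟩
      · obtain ⟨c, hc, hct⟩ := ih (t - 1) (by omega) (by omega)
        refine ⟨1 :: c, List.Forall₂.cons (by simp) hc, ?_⟩
        simp [hct]; omega
    · fin_cases x
      · simp at h₁ h₂
        obtain ⟨c, hc, hct⟩ := ih t h₁ h₂
        exact ⟨0 :: c, List.Forall₂.cons (by simp) hc, by simp [hct]⟩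
      · simp at h₁ h₂
        obtain ⟨c, hc, hct⟩ := ih (t - 1) (by omega) (by omega)
        refine ⟨1 :: c, List.Forall₂.cons (by simp) hc, ?_⟩
        simp [hct]; omega

theorem count_zero_add_count_one (c : List (Fin 2)) : c.count 0 + c.count 1 = c.length := by
  induction c with
  | nil => rfl
  | cons a c ih => fin_cases a <;> simp <;> omega

theorem perm_of_count_one_eq {c d : List (Fin 2)} (hl : c.length = d.length)
    (h : c.count 1 = d.count 1) : c.Perm d := by
  rw [List.perm_iff_count]
  have hc := count_zero_add_count_one c
  have hd := count_zero_add_count_one d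
  intro a
  fin_cases a
  · simp only [Fin.zero_eta]; omega
  · exact h

theorem abelianCompat_iff_of_binary (u v : PWord (Fin 2)) :
    AbelianCompat u v ↔ u.length = v.length ∧
      u.count (some 1) ≤ v.count (some 1) + v.count none ∧
      v.count (some 1) ≤ u.count (some 1) + u.count none := by
  constructor
  · rintro ⟨c, d, hc, hd, hp⟩
    have := hc.count_bounds 1
    have := hd.count_bounds 1
    have := hp.count_eq 1
    exact ⟨hc.length_eq.trans (hp.length_eq.trans hd.length_eq.symm), by omega, by omega⟩
  · rintro ⟨hl, h₁, h₂⟩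
    obtain ⟨c, hc, hct⟩ := exists_isCompletion_count_one u
      (max (u.count (some 1)) (v.count (some 1))) (by omega) (by omega)
    obtain ⟨d, hd, hdt⟩ := exists_isCompletion_count_one v
      (max (u.count (some 1)) (v.count (some 1))) (by omega) (by omega)
    exact ⟨c, d, hc, hd, perm_of_count_one_eq
      (hc.length_eq.symm.trans (hl.trans hd.length_eq)) (hct.trans hdt.symm)⟩

theorem hasAbelianBorder_iff_of_binary (w : PWord (Fin 2)) (k : ℕ) :
    HasAbelianBorder w k ↔ 1 ≤ k ∧ k ≤ w.length - 1 ∧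
      (w.take k).count (some 1) ≤
        (w.drop (w.length - k)).count (some 1) + (w.drop (w.length - k)).count none ∧
      (w.drop (w.length - k)).count (some 1) ≤
        (w.take k).count (some 1) + (w.take k).count none := by
  rw [HasAbelianBorder, abelianCompat_iff_of_binary]
  constructor
  · rintro ⟨h₁, h₂, -, h⟩
    exact ⟨h₁, h₂, h⟩
  · rintro ⟨h₁, h₂, h⟩
    exact ⟨h₁, h₂, by simp; omega, h⟩

theorem count_take_add_count_drop {α : Type*} [BEq α] (a : α) (l : List α) (k : ℕ) :
    (l.take k).count a + (l.drop k).count a = l.count a := by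
  rw [← List.count_append, List.take_append_drop]

theorem count_drop_anti {α : Type*} [BEq α] (a : α) (l : List α) {j k : ℕ} (h : j ≤ k) :
    (l.drop k).count a ≤ (l.drop j).count a :=
  (List.drop_sublist_drop_left l h).count_le a

theorem count_take_mono {α : Type*} [BEq α] (a : α) (l : List α) {j k : ℕ} (h : j ≤ k) :
    (l.take j).count a ≤ (l.take k).count a :=
  (List.take_sublist_take_left h).count_le a

/-- For a word of length `2 * r + 4` whose only hole is in the first half, where no `1` occurs,
the minimal abelian border length is `2 * r + 3` exactly when the first letter is `0` and the last
two letters are `1`. -/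
theorem isLeast_hasAbelianBorder_iff (r : ℕ) (w : PWord (Fin 2)) (hw : w.length = 2 * r + 4)
    (hn : w.count none = 1) (hh : (w.take (r + 2)).count none = 1)
    (ho : (w.take (r + 2)).count (some 1) = 0) :
    IsLeast {k | HasAbelianBorder w k} (2 * r + 3) ↔
      (w.take 1).count none = 0 ∧ (w.drop (2 * r + 2)).count (some 1) = 2 := by
  have hs := count_take_add_count_drop (some 1) w
  have hz := count_take_add_count_drop none w
  have hd2 : (w.drop (2 * r + 2)).count (some 1) ≤ 2 := by
    refine List.count_le_length.trans ?_
    simp; omega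
  have hd1 : (w.drop (2 * r + 3)).count (some 1) ≤ 1 := by
    refine List.count_le_length.trans ?_
    simp; omega
  have hm1 := count_take_mono (some 1) w (show 1 ≤ r + 2 by omega)
  have hm2 := count_take_mono none w (show r + 2 ≤ 2 * r + 2 by omega)
  have hm3 := count_take_mono none w (show r + 2 ≤ 2 * r + 3 by omega)
  have hm4 := count_take_mono (some 1) w (show 2 ≤ r + 2 by omega)
  have hs1 := hs 1
  have hs2 := hs 2
  have hs3 := hs (2 * r + 2)
  have hs4 := hs (2 * r + 3)
  have hsr := hs (r + 2)
  constructor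
  · rintro ⟨-, hlow⟩
    have h1 : ¬ HasAbelianBorder w 1 := fun h => by have := hlow h; omega
    have h2 : ¬ HasAbelianBorder w (2 * r + 2) := fun h => by have := hlow h; omega
    rw [hasAbelianBorder_iff_of_binary, hw] at h1 h2
    rw [show 2 * r + 4 - 1 = 2 * r + 3 by omega] at h1
    rw [show 2 * r + 4 - (2 * r + 2) = 2 by omega] at h2
    omega
  · rintro ⟨h1, h2⟩
    have hlast : (w.drop (2 * r + 3)).count (some 1) = 1 := by
      have h : (w.drop (2 * r + 2)).count (some 1) ≤
          (w.drop (2 * r + 3)).count (some 1) + 1 := by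
        rw [List.drop_eq_getElem_cons (by omega : 2 * r + 2 < w.length), List.count_cons]
        change (w.drop (2 * r + 3)).count (some 1) + _ ≤ _
        split <;> omega
      omega
    refine ⟨?_, fun k hk => ?_⟩
    · rw [Set.mem_ofPred_eq, hasAbelianBorder_iff_of_binary, hw,
        show 2 * r + 4 - (2 * r + 3) = 1 by omega]
      omega
    · rw [Set.mem_ofPred_eq, hasAbelianBorder_iff_of_binary, hw] at hk
      by_contra! hlt
      obtain ⟨hk1, -, -, hk2⟩ := hk
      rcases Nat.lt_or_ge k 2 with hk3 | hk3
      · obtain rfl : k = 1 := by omega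
        rw [show 2 * r + 4 - 1 = 2 * r + 3 by omega] at hk2
        omega
      · have hsk := hs k
        have hzk := hz k
        rcases Nat.le_total k (r + 2) with hkr | hkr
        · have := count_take_mono (some 1) w hkr
          have := count_take_mono none w hkr
          have := count_drop_anti (some 1) w (show 2 * r + 4 - k ≤ 2 * r + 2 by omega)
          omega
        · have := count_drop_anti (some 1) w (show 2 * r + 4 - k ≤ r + 2 by omega)
          have := count_drop_anti (some 1) w (show k ≤ 2 * r + 2 by omega)
          omega

/-- The word `0^(i+1) ♦ 0^(r-i) v 1 1`. -/
def extremalWord (r : ℕ) (p : Fin (r + 1) × List.Vector (Fin 2) r) : PWord (Fin 2) :=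
  (List.replicate (p.1 + 1) (some 0) ++ none :: List.replicate (r - p.1) (some 0)) ++
    (p.2.toList ++ [1, 1]).map some

theorem extremalWord_injective (r : ℕ) : Function.Injective (extremalWord r) := by
  rintro ⟨i, v⟩ ⟨j, v'⟩ h
  have hij := congrArg (List.idxOf none) h
  simp [extremalWord, List.idxOf_append] at hij
  obtain rfl : i = j := Fin.ext hij
  simp only [extremalWord, List.append_cancel_left_eq] at h
  have h' := (Option.some_injective (Fin 2)).list_map h
  rw [List.append_cancel_right_eq] at h'
  rw [List.Vector.toList_injective h']

theorem count_none_map_some {α : Type*} [DecidableEq α] (l : List α) :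
    (l.map some).count none = 0 := by
  simp [List.count_eq_zero]

theorem eq_replicate_some_zero {l : PWord (Fin 2)} (h₀ : l.count none = 0)
    (h₁ : l.count (some 1) = 0) : l = List.replicate l.length (some 0) := by
  rw [List.eq_replicate_iff]
  refine ⟨rfl, fun b hb => ?_⟩
  rw [List.count_eq_zero] at h₀ h₁
  rcases b with _ | x
  · exact absurd hb h₀
  · fin_cases x
    · rfl
    · exact absurd hb h₁

theorem exists_eq_map_some {α : Type*} {l : List (Option α)} (h : none ∉ l) :
    ∃ u : List α, l = u.map some := by
  induction l with
  | nil => exact ⟨[], rfl⟩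
  | cons o l ih =>
    simp only [List.mem_cons, not_or] at h
    obtain ⟨u, rfl⟩ := ih h.2
    obtain ⟨x, hx⟩ := Option.ne_none_iff_exists.1 (Ne.symm h.1)
    exact ⟨x :: u, by simp [hx]⟩

theorem mem_range_extremalWord (r : ℕ) (w : PWord (Fin 2)) (hw : w.length = 2 * r + 4)
    (hn : w.count none = 1) (hh : (w.take (r + 2)).count none = 1)
    (ho : (w.take (r + 2)).count (some 1) = 0) (h0 : (w.take 1).count none = 0)
    (h2 : (w.drop (2 * r + 2)).count (some 1) = 2) : w ∈ Set.range (extremalWord r) := by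
  have hz := count_take_add_count_drop none w (r + 2)
  have hdrop : none ∉ w.drop (r + 2) := List.count_eq_zero.1 (by omega)
  obtain ⟨u, hu⟩ := exists_eq_map_some hdrop
  have hul : u.length = r + 2 := by
    have := congrArg List.length hu
    simp at this; omega
  have hmem : none ∈ w.take (r + 2) := List.count_pos_iff.1 (by omega)
  obtain ⟨s, t, hst⟩ := List.append_of_mem hmem
  have hlen := congrArg List.length hst
  simp only [List.length_take, List.length_append, List.length_cons, hw] at hlen
  rw [hst] at hh ho
  simp at hh ho
  have hs := eq_replicate_some_zero (l := s) (by omega) ho.1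
  have ht := eq_replicate_some_zero (l := t) (by omega) ho.2
  have hspos : 1 ≤ s.length := by
    by_contra! hc
    obtain rfl : s = [] := List.length_eq_zero_iff.1 (by omega)
    have : w.take 1 = [none] := by
      rw [show w.take 1 = (w.take (r + 2)).take 1 by rw [List.take_take]; congr 1, hst]
      simp
    simp [this] at h0
  have hu2 : u.drop r = [1, 1] := by
    have hd : w.drop (2 * r + 2) = (u.drop r).map some := by
      rw [List.map_drop, ← hu, List.drop_drop]; congr 1; omega
    rw [hd, List.count_map_of_injective _ _ (Option.some_injective _)] at h2
    have hl : (u.drop r).length = 2 := by simp [hul]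
    have := List.eq_replicate_iff.2 ⟨hl, fun b hb =>
      ((List.count_eq_length.1 (h2.trans hl.symm)) b hb).symm⟩
    simpa using this
  refine ⟨(⟨s.length - 1, by omega⟩, ⟨u.take r, by simp [hul]⟩), ?_⟩
  rw [← List.take_append_drop (r + 2) w, hst, hu, extremalWord]
  congr 1
  · dsimp only
    rw [show s.length - 1 + 1 = s.length by omega, show r - (s.length - 1) = t.length by omega,
      ← hs, ← ht]
  · rw [← hu2]
    simp [List.Vector.toList]

theorem countP_isNone_eq_count {α : Type*} [DecidableEq α] (w : List (Option α)) :
    w.countP (·.isNone) = w.count none := by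
  rw [List.count]
  congr 1
  funext o
  cases o <;> rfl

theorem setOf_eq_range_extremalWord (r : ℕ) :
    {w : PWord (Fin 2) | w.length = 2 * r + 4 ∧ w.countP (·.isNone) = 1 ∧
        (∃ i, i ≤ r + 1 ∧ w.getD i (some 0) = none) ∧
        (w.take (r + 2)).count (some 1) = 0 ∧
        IsLeast {k | HasAbelianBorder w k} (2 * r + 3)} = Set.range (extremalWord r) := by
  ext w
  simp only [Set.mem_ofPred_eq, countP_isNone_eq_count]
  constructor
  · rintro ⟨hw, hn, ⟨i, hi, hwi⟩, ho, hl⟩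
    have hmem : none ∈ w.take (r + 2) := by
      rw [List.getD_eq_getElem _ _ (by omega)] at hwi
      rw [List.mem_take_iff_getElem]
      exact ⟨i, by omega, hwi⟩
    have hpos := List.count_pos_iff.2 hmem
    have := count_take_add_count_drop none w (r + 2)
    have hh : (w.take (r + 2)).count none = 1 := by omega
    obtain ⟨h0, h2⟩ := (isLeast_hasAbelianBorder_iff r w hw hn hh ho).1 hl
    exact mem_range_extremalWord r w hw hn hh ho h0 h2
  · rintro ⟨⟨⟨i, hi⟩, v⟩, rfl⟩
    have hlen : (List.replicate (i + 1) (some (0 : Fin 2)) ++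
        none :: List.replicate (r - i) (some 0)).length = r + 2 := by
      simp; omega
    have htake : (extremalWord r (⟨i, hi⟩, v)).take (r + 2) =
        List.replicate (i + 1) (some (0 : Fin 2)) ++ none :: List.replicate (r - i) (some 0) :=
      List.take_left' hlen
    have hw : (extremalWord r (⟨i, hi⟩, v)).length = 2 * r + 4 := by
      simp [extremalWord]; omega
    have hn : (extremalWord r (⟨i, hi⟩, v)).count none = 1 := by
      simp only [extremalWord, List.count_append, count_none_map_some]
      simp [List.count_replicate]
    have hh : ((extremalWord r (⟨i, hi⟩, v)).take (r + 2)).count none = 1 := by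
      rw [htake]; simp [List.count_replicate]
    have ho : ((extremalWord r (⟨i, hi⟩, v)).take (r + 2)).count (some 1) = 0 := by
      rw [htake]; simp [List.count_replicate]
    refine ⟨hw, hn, ⟨i + 1, by omega, ?_⟩, ho,
      (isLeast_hasAbelianBorder_iff r _ hw hn hh ho).2 ⟨?_, ?_⟩⟩
    · rw [List.getD_eq_getElem _ _ (by omega)]
      simp [extremalWord]
    · simp [extremalWord, List.replicate_succ]
    · have : extremalWord r (⟨i, hi⟩, v) =
          ((List.replicate (i + 1) (some 0) ++ none :: List.replicate (r - i) (some 0)) ++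
            v.toList.map some) ++ [some 1, some 1] := by
        simp [extremalWord]
      rw [this, List.drop_left' (by simp; omega)]
      rfl

/-- For even `n ≥ 4`, the number of binary partial words of length `n` with exactly
one hole, located at a position `i ≤ n/2 - 1`, with no occurrence of the letter `1`
in the first half, and with minimal abelian border length `n - 1`, is
`(n/2 - 1) * 2^(n/2 - 2)`. -/
theorem stmt_14 (n : ℕ) (hn : 4 ≤ n) (he : Even n) :
    Nat.card {w : PWord (Fin 2) // w.length = n ∧ w.countP (·.isNone) = 1 ∧
        (∃ i, i ≤ n / 2 - 1 ∧ w.getD i (some 0) = none) ∧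
        (w.take (n / 2)).count (some 1) = 0 ∧
        IsLeast {k | HasAbelianBorder w k} (n - 1)} =
      (n / 2 - 1) * 2 ^ (n / 2 - 2) := by
  obtain ⟨r, rfl⟩ : ∃ r, n = 2 * r + 4 := by
    obtain ⟨m, rfl⟩ := he
    exact ⟨m - 2, by omega⟩
  rw [show (2 * r + 4) / 2 = r + 2 by omega, show r + 2 - 1 = r + 1 by omega,
    show 2 * r + 4 - 1 = 2 * r + 3 by omega, show r + 2 - 2 = r by omega]
  have h := congrArg (fun s : Set (PWord (Fin 2)) => Nat.card s) (setOf_eq_range_extremalWord r)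
  refine h.trans ?_
  rw [Nat.card_range_of_injective (extremalWord_injective r), Nat.card_eq_fintype_card,
    Fintype.card_prod, card_vector, Fintype.card_fin, Fintype.card_fin]
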